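/- Let ε ≥ 0 and p < 1 be real numbers. If a function f : ℝⁿ \ B → ℝⁿ satisfies |⟨f(x), f(y)⟩ − ⟨x, y⟩| ≤ ε·‖x‖^p·‖y‖^p for all x, y ∈ ℝⁿ \ B, then f satisfies the orthogonality equation ⟨f(x), f(y)⟩ = ⟨x, y⟩ for all x, y ∈ ℝⁿ \ B. -/

import Mathlib

open scoped RealInnerProductSpace

/-- An orthonormal family of `n` vectors in `ℝⁿ` satisfies Parseval's identity. -/
theorem inner_eq_sum_of_orthonormal {n : ℕ} {u : Fin n → EuclideanSpace ℝ (Fin n)}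
    (hu : Orthonormal ℝ u) (a b : EuclideanSpace ℝ (Fin n)) :
    ⟪a, b⟫ = ∑ i, ⟪a, u i⟫ * ⟪b, u i⟫ := by
  have hspan : Submodule.span ℝ (Set.range u) = ⊤ :=
    hu.linearIndependent.span_eq_top_of_card_eq_finrank' (by simp)
  have h := (OrthonormalBasis.mk hu hspan.ge).sum_inner_mul_inner a b
  simp only [OrthonormalBasis.coe_mk] at h
  rw [← h]
  exact Finset.sum_congr rfl fun i _ => by rw [real_inner_comm b]

open Filter Topology in
theorem stmt_19 (n : ℕ) (hn : 2 ≤ n) (d : ℝ) (hd : 0 < d)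
    (ε p : ℝ) (hε : 0 ≤ ε) (hp : p < 1)
    (S : Set (EuclideanSpace ℝ (Fin n))) (hS : S = {x : EuclideanSpace ℝ (Fin n) | d ≤ ‖x‖})
    (f : EuclideanSpace ℝ (Fin n) → EuclideanSpace ℝ (Fin n))
    (hf : ∀ x ∈ S, ∀ y ∈ S,
      |⟪f x, f y⟫ - ⟪x, y⟫| ≤ ε * ‖x‖ ^ p * ‖y‖ ^ p) :
    ∀ x ∈ S, ∀ y ∈ S, ⟪f x, f y⟫ = ⟪x, y⟫ := by
  let e : Fin n → EuclideanSpace ℝ (Fin n) := fun i => EuclideanSpace.single i 1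
  have he : Orthonormal ℝ e := EuclideanSpace.orthonormal_single
  let r : ℕ → ℝ := fun k => (k + 1) * d
  have hr_pos : ∀ k, 0 < r k := fun k => by positivity
  have hdr : ∀ k, d ≤ r k := fun k => le_mul_of_one_le_left hd.le (by simp)
  have hr_tendsto : Tendsto r atTop atTop :=
    (tendsto_atTop_add_const_right _ 1 tendsto_natCast_atTop_atTop).atTop_mul_const hd
  have hnorm : ∀ k i, ‖r k • e i‖ = r k := fun k i => by
    rw [norm_smul, he.1 i, mul_one, Real.norm_of_nonneg (hr_pos k).le]
  have hmem : ∀ k i, r k • e i ∈ S := fun k i => by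
    rw [hS, Set.mem_ofPred_eq, hnorm]
    exact hdr k
  let v : ℕ → Fin n → EuclideanSpace ℝ (Fin n) := fun k i => (r k)⁻¹ • f (r k • e i)
  let c : ℕ → ℝ := fun k => r k ^ (p - 1)
  have hc : Tendsto c atTop (𝓝 0) := by
    have h := (tendsto_rpow_neg_atTop (sub_pos.2 hp)).comp hr_tendsto
    simpa [c, Function.comp_def] using h
  have hcr : ∀ k, r k ^ p = c k * r k := fun k => by
    rw [← Real.rpow_add_one (hr_pos k).ne', sub_add_cancel]
  have hfv : ∀ x ∈ S, ∀ k i, |⟪f x, v k i⟫ - ⟪x, e i⟫| ≤ ε * ‖x‖ ^ p * c k := by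
    intro x hx k i
    have h := hf x hx _ (hmem k i)
    have hrk := hr_pos k
    rw [hnorm, hcr, inner_smul_right] at h
    have h2 : ⟪f x, f (r k • e i)⟫ - r k * ⟪x, e i⟫ = r k * (⟪f x, v k i⟫ - ⟪x, e i⟫) := by
      simp only [v, inner_smul_right]
      field_simp
    rw [h2, abs_mul, abs_of_pos hrk] at h
    exact le_of_mul_le_mul_left (by linarith) hrk
  have hvv : ∀ k i j, |⟪v k i, v k j⟫ - ⟪e i, e j⟫| ≤ ε * c k * c k := by
    intro k i j
    have h := hfv _ (hmem k i) k j
    have hrk := hr_pos k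
    rw [hnorm, hcr, real_inner_smul_left] at h
    have h2 : ⟪f (r k • e i), v k j⟫ - r k * ⟪e i, e j⟫ = r k * (⟪v k i, v k j⟫ - ⟪e i, e j⟫) := by
      simp only [v, real_inner_smul_left]
      field_simp
    rw [h2, abs_mul, abs_of_pos hrk] at h
    exact le_of_mul_le_mul_left (by linarith) hrk
  have hfv_lim : ∀ x ∈ S, ∀ i, Tendsto (fun k => ⟪f x, v k i⟫) atTop (𝓝 ⟪x, e i⟫) := by
    intro x hx i
    rw [tendsto_iff_norm_sub_tendsto_zero]
    refine squeeze_zero (fun _ => norm_nonneg _) (fun k => hfv x hx k i) ?_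
    simpa using hc.const_mul (ε * ‖x‖ ^ p)
  have hvv_lim : ∀ i j, Tendsto (fun k => ⟪v k i, v k j⟫) atTop (𝓝 ⟪e i, e j⟫) := by
    intro i j
    rw [tendsto_iff_norm_sub_tendsto_zero]
    refine squeeze_zero (fun _ => norm_nonneg _) (fun k => hvv k i j) ?_
    simpa using (hc.const_mul ε).mul hc
  have hv_bdd : ∃ᶠ k in atTop, v k ∈ Metric.closedBall 0 2 := by
    refine Eventually.frequently ?_
    have h : ∀ᶠ k in atTop, ∀ i, ⟪v k i, v k i⟫ < 4 :=
      eventually_all.2 fun i => (hvv_lim i i).eventually_lt_const (by simp [he.1 i])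
    filter_upwards [h] with k hk
    rw [mem_closedBall_zero_iff, pi_norm_le_iff_of_nonneg zero_le_two]
    intro i
    have := hk i
    rw [real_inner_self_eq_norm_sq] at this
    nlinarith [norm_nonneg (v k i)]
  obtain ⟨u, -, φ, hφ, hu⟩ :=
    tendsto_subseq_of_frequently_bounded Metric.isBounded_closedBall hv_bdd
  have hui : ∀ i, Tendsto (fun k => v (φ k) i) atTop (𝓝 (u i)) := tendsto_pi_nhds.1 hu
  have huu : ∀ i j, ⟪u i, u j⟫ = ⟪e i, e j⟫ := fun i j =>
    tendsto_nhds_unique ((hui i).inner (hui j)) ((hvv_lim i j).comp hφ.tendsto_atTop)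
  have hfu : ∀ x ∈ S, ∀ i, ⟪f x, u i⟫ = ⟪x, e i⟫ := fun x hx i =>
    tendsto_nhds_unique (tendsto_const_nhds.inner (hui i))
      ((hfv_lim x hx i).comp hφ.tendsto_atTop)
  have hu_orth : Orthonormal ℝ u := by
    rw [orthonormal_iff_ite] at he ⊢
    intro i j
    rw [huu, he]
  intro x hx y hy
  rw [inner_eq_sum_of_orthonormal hu_orth, inner_eq_sum_of_orthonormal he x y]
  simp only [hfu x hx, hfu y hy]
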